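/- Let Σ be a symmetric positive definite d×d real matrix, F an l×d real matrix with rows F₁,…,F_l, g ∈ ℝˡ, w₀, w₁ ∈ ℝᵈ, and η ≥ 0, ε ≥ 0. Suppose that for every row index r ∈ {1,…,l}: F_r w₀ + g_r − √(F_r Σ F_rᵀ) − (η + ε)·‖F_r‖₂ ≥ 0 and F_r w₁ + g_r − √(F_r Σ F_rᵀ) − (η + ε)·‖F_r‖₂ ≥ 0. Then for every point c ∈ ℝᵈ lying within Euclidean distance η of the line segment from w₀ to w₁ and every p ∈ ℝᵈ with (p−c)ᵀ Σ⁻¹ (p−c) ≤ 1, it holds that F_r p + g_r ≥ ε·‖F_r‖₂ for every r ∈ {1,…,l}. -/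

import Mathlib

open Matrix

/-- The Euclidean (2-)norm on `ℝᵈ`. -/
noncomputable def norm2 {d : ℕ} (x : Fin d → ℝ) : ℝ := Real.sqrt (∑ i, x i ^ 2)

/-- `c` lies within Euclidean distance `η` of the line segment from `a` to `b`. -/
def nearSegment {d : ℕ} (c a b : Fin d → ℝ) (η : ℝ) : Prop :=
  ∃ γ : ℝ, 0 ≤ γ ∧ γ ≤ 1 ∧ norm2 (c - (γ • a + (1 - γ) • b)) ≤ η

lemma ellipsoid_bound {d : ℕ} (S : Matrix (Fin d) (Fin d) ℝ) (hpd : S.PosDef)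
    (f u : Fin d → ℝ) (hu : u ⬝ᵥ (S⁻¹ *ᵥ u) ≤ 1) :
    -Real.sqrt (f ⬝ᵥ (S *ᵥ f)) ≤ f ⬝ᵥ u := by
  have hnn : ∀ x : Fin d → ℝ, 0 ≤ x ⬝ᵥ (S *ᵥ x) := fun x => by
    simpa using hpd.posSemidef.dotProduct_mulVec_nonneg x
  have hdet : IsUnit S.det := (Matrix.isUnit_iff_isUnit_det S).1 hpd.isUnit
  obtain ⟨v, hv⟩ : ∃ v, v = S⁻¹ *ᵥ u := ⟨_, rfl⟩
  have hSv : S *ᵥ v = u := by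
    rw [hv, Matrix.mulVec_mulVec, Matrix.mul_nonsing_inv S hdet, Matrix.one_mulVec]
  have hT : Sᵀ = S := by simpa using hpd.isHermitian.eq
  have hsym : v ⬝ᵥ (S *ᵥ f) = f ⬝ᵥ u := by
    rw [Matrix.dotProduct_mulVec, ← Matrix.mulVec_transpose, hT, hSv, dotProduct_comm]
  rw [← hv] at hu
  have hq : ∀ t : ℝ, 0 ≤ (f ⬝ᵥ (S *ᵥ f)) * (t * t) + (2 * (f ⬝ᵥ u)) * t + u ⬝ᵥ v := by
    intro t
    have h := hnn (t • f + v)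
    simp only [Matrix.mulVec_add, Matrix.mulVec_smul, hSv, add_dotProduct, dotProduct_add,
      smul_dotProduct, dotProduct_smul, smul_eq_mul, hsym] at h
    rw [dotProduct_comm v u] at h
    linarith
  have hD := discrim_le_zero hq
  unfold discrim at hD
  have hA := hnn f
  have : (f ⬝ᵥ u) ^ 2 ≤ f ⬝ᵥ (S *ᵥ f) := by
    nlinarith [mul_le_mul_of_nonneg_left hu hA]
  exact (abs_le.1 (Real.abs_le_sqrt this)).1

lemma cs_bound {d : ℕ} (f u : Fin d → ℝ) : -(norm2 f * norm2 u) ≤ f ⬝ᵥ u := by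
  have h := Finset.sum_mul_sq_le_sq_mul_sq Finset.univ f u
  have h2 := (abs_le.1 (Real.abs_le_sqrt h)).1
  rw [Real.sqrt_mul (Finset.sum_nonneg fun i _ => sq_nonneg _)] at h2
  exact h2

/-- **Lemma 3 of the paper.** If for every row `r` of `F` the endpoint
margin conditions `F_r w + g_r - √(F_r S F_rᵀ) - (η+ε)‖F_r‖₂ ≥ 0` hold at both segment
endpoints `w₀, w₁`, then for every center `c` in the `η`-tube of the segment and every
`p` in the ellipsoid with shape `S` centered at `c`, it holds that
`F_r p + g_r ≥ ε‖F_r‖₂` for every row `r`. -/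
theorem swarm_predicate_along_tube (d l : ℕ)
    (S : Matrix (Fin d) (Fin d) ℝ) (hpd : S.PosDef)
    (F : Matrix (Fin l) (Fin d) ℝ) (g : Fin l → ℝ)
    (w₀ w₁ : Fin d → ℝ) (η ε : ℝ) (hη : 0 ≤ η) (hε : 0 ≤ ε)
    (h₀ : ∀ r : Fin l,
      F r ⬝ᵥ w₀ + g r - Real.sqrt (F r ⬝ᵥ (S *ᵥ F r)) - (η + ε) * norm2 (F r) ≥ 0)
    (h₁ : ∀ r : Fin l,
      F r ⬝ᵥ w₁ + g r - Real.sqrt (F r ⬝ᵥ (S *ᵥ F r)) - (η + ε) * norm2 (F r) ≥ 0) :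
    ∀ c : Fin d → ℝ, nearSegment c w₀ w₁ η →
      ∀ p : Fin d → ℝ, (p - c) ⬝ᵥ (S⁻¹ *ᵥ (p - c)) ≤ 1 →
        ∀ r : Fin l, F r ⬝ᵥ p + g r ≥ ε * norm2 (F r) := by
  rintro c ⟨γ, h0, h1, hc⟩ p hp r
  have e1 := ellipsoid_bound S hpd (F r) (p - c) hp
  have e2 := cs_bound (F r) (c - (γ • w₀ + (1 - γ) • w₁))
  have hn : 0 ≤ norm2 (F r) := Real.sqrt_nonneg _
  have e3 := mul_le_mul_of_nonneg_left hc hn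
  have a0 := mul_nonneg h0 (h₀ r)
  have a1 := mul_nonneg (sub_nonneg.2 h1) (h₁ r)
  simp only [dotProduct_sub, dotProduct_add, dotProduct_smul, smul_eq_mul] at e1 e2
  linarith
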